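/- arXiv:1208.6267 — 2 statements merged into one kernel-verified Lean document; each statement's English description precedes it below -/
import Mathlib

section
/- Let K be a field and B a K-algebra domain graded by ℤʳ, B = ⊕_{m ∈ ℤʳ} B_m. Fix λ ∈ ℤʳ and h∘ ∈ (Kˣ)ʳ, let σ be the K-algebra automorphism of B defined on homogeneous elements b ∈ B_m by σ(b) = h∘ᵐ·b (where h∘ᵐ := ∏ᵢ (h∘)ᵢ^{mᵢ}), and assume λ∘ := h∘^λ ∈ Kˣ is not a root of unity. Let δ be a K-linear σ-derivation of B (δ(ab) = σ(a)δ(b) + δ(a)b) which is locally nilpotent (for every b ∈ B there is m ≥ 1 with δᵐ(b) = 0) and which shifts degrees by λ, i.e., δ(B_m) ⊆ B_{m+λ} for all m ∈ ℤʳ. If δ is an inner σ-derivation, i.e., there is c ∈ B with δ(b) = c·b − σ(b)·c for all b ∈ B, then δ = 0; if moreover c is homogeneous of degree λ, then c = 0. -/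
/-- `tᵐ = t₁^{m₁} ⋯ t_r^{m_r}` for a torus element `t ∈ (Kˣ)ʳ` and a character
`m ∈ ℤʳ`. -/
def tpow {K : Type*} [Field K] {r : ℕ} (t : Fin r → Kˣ) (m : Fin r → ℤ) : Kˣ :=
  ∏ i, t i ^ m i

/-- If an element `d` of a domain induces a locally nilpotent inner
`σ`-derivation, where `σ d = q • d` with `q` not a root of unity, then `d = 0`. -/
theorem eq_zero_of_inner_locally_nilpotent {K B : Type*} [Field K] [Ring B] [Algebra K B]
    [IsDomain B] (σ : B ≃ₐ[K] B) (δ : B →ₗ[K] B) {q : K} {d : B}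
    (hq : ∀ n : ℕ, 1 ≤ n → q ^ n ≠ 1) (hd : σ d = q • d)
    (hδ : ∀ b, δ b = d * b - σ b * d) (hnil : ∃ n : ℕ, (δ ^ n) d = 0) : d = 0 := by
  have hpow (k : ℕ) : δ (d ^ k) = (1 - q ^ k) • d ^ (k + 1) := by
    rw [hδ, map_pow, hd, smul_pow, smul_mul_assoc, ← pow_succ, ← pow_succ', sub_smul, one_smul]
  have hiter (n : ℕ) : ∃ a : K, a ≠ 0 ∧ (δ ^ n) d = a • d ^ (n + 1) := by
    induction n with
    | zero => exact ⟨1, one_ne_zero, by simp⟩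
    | succ n ih =>
      obtain ⟨a, ha, h⟩ := ih
      refine ⟨a * (1 - q ^ (n + 1)),
        mul_ne_zero ha (sub_ne_zero.2 (hq (n + 1) (by omega)).symm), ?_⟩
      rw [pow_succ', Module.End.mul_apply, h, map_smul, hpow, smul_smul]
  obtain ⟨n, hn⟩ := hnil
  obtain ⟨a, ha, h⟩ := hiter n
  have hz : d ^ (n + 1) = 0 := by
    have h' := h.symm.trans hn
    rwa [← Units.val_mk0 ha, ← Units.smul_def, smul_eq_zero_iff_eq] at h'
  exact eq_zero_of_pow_eq_zero hz

/-- **Lemma 3.4(b)** of Goodearl–Yakimov: let `B` be a `ℤʳ`-graded `K`-algebra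
domain, `σ` the automorphism given on homogeneous elements of degree `m` by
multiplication by `h∘ᵐ`, and `δ` a locally nilpotent `σ`-derivation shifting
degrees by `λ`, where `λ∘ := h∘^λ` is not a root of unity.  If `δ` is an inner
`σ`-derivation, given by `c ∈ B`, then `δ = 0`; and if moreover `c` is
homogeneous of degree `λ`, then `c = 0`. -/
theorem stmt9 {K : Type*} [Field K] {B : Type*} [Ring B] [Algebra K B]
    [IsDomain B]
    {r : ℕ} (𝒜 : (Fin r → ℤ) → Submodule K B) [GradedAlgebra 𝒜]
    (lam : Fin r → ℤ) (h0 : Fin r → Kˣ)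
    (σ : B ≃ₐ[K] B)
    (hσ : ∀ m : Fin r → ℤ, ∀ b ∈ 𝒜 m, σ b = ((tpow h0 m : Kˣ) : K) • b)
    (hroot : ∀ n : ℕ, 1 ≤ n → (tpow h0 lam) ^ n ≠ 1)
    (δ : B →ₗ[K] B)
    (hder : ∀ a b : B, δ (a * b) = σ a * δ b + δ a * b)
    (hnil : ∀ b : B, ∃ n : ℕ, (δ ^ n) b = 0)
    (hshift : ∀ m : Fin r → ℤ, ∀ b ∈ 𝒜 m, δ b ∈ 𝒜 (m + lam)) :
    ∀ c : B, (∀ b : B, δ b = c * b - σ b * c) →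
      δ = 0 ∧ (c ∈ 𝒜 lam → c = 0) := by
  intro c hc
  set d : B := (DirectSum.decompose 𝒜 c lam : B) with hd_def
  have hd : d ∈ 𝒜 lam := SetLike.coe_mem _
  have hhom (m : Fin r → ℤ) (b : B) (hb : b ∈ 𝒜 m) : δ b = d * b - σ b * d := by
    have hσb : σ b ∈ 𝒜 m := by
      rw [hσ m b hb]
      exact Submodule.smul_mem _ _ hb
    have hright : (DirectSum.decompose 𝒜 (c * b) (m + lam) : B) = d * b := by
      rw [add_comm m lam]
      exact DirectSum.coe_decompose_mul_add_of_right_mem 𝒜 hb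
    have hleft : (DirectSum.decompose 𝒜 (σ b * c) (m + lam) : B) = σ b * d :=
      DirectSum.coe_decompose_mul_add_of_left_mem 𝒜 hσb
    rw [← DirectSum.decompose_of_mem_same 𝒜 (hshift m b hb), hc b, DirectSum.decompose_sub,
      DirectSum.sub_apply, AddSubgroupClass.coe_sub, hright, hleft]
  have hδ (b : B) : δ b = d * b - σ b * d := by
    induction b using DirectSum.Decomposition.inductionOn 𝒜 with
    | zero => simp
    | homogeneous b => exact hhom _ _ b.2
    | add a b ha hb => rw [map_add, ha, hb, map_add]; noncomm_ring
  have hq (n : ℕ) (hn : 1 ≤ n) : ((tpow h0 lam : Kˣ) : K) ^ n ≠ 1 :=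
    fun h => hroot n hn (Units.ext (by simpa using h))
  have hd0 : d = 0 :=
    eq_zero_of_inner_locally_nilpotent σ δ hq (hσ lam d hd) hδ (hnil d)
  refine ⟨LinearMap.ext fun b => by simp [hδ, hd0], fun hcm => ?_⟩
  rw [← hd0, hd_def, DirectSum.decompose_of_mem_same 𝒜 hcm]
end

section
/- Let R be a CGL extension of length N over an infinite field K, and let n, μ, d_k, and y₁,…,y_N be as produced by the structure theorem for CGL extensions (so each y_k is homogeneous and {y_j : j ∈ [1,k], s(j) > k} is a complete irredundant list up to scalar multiples of the homogeneous prime elements of R_k). Then y_j·x_k = α_{kj}⁻¹·x_k·y_j for all j, k ∈ [1,N] with s(j) > k, where α_{kj} := ∏_{m=0}^{O₋(j)} λ_{k,p^m(j)}. Consequently, every homogeneous prime element of R quasi-commutes with each of x₁,…,x_N, and x_k·N(R) = N(R)·x_k for all k ∈ [1,N]. -/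
section CGLDefs

/-- The ordered monomial `x^f = x₁^{f₁} ⋯ x_N^{f_N}`. -/
def xmon {R : Type*} [Ring R] {N : ℕ} (x : Fin N → R) (f : Fin N → ℕ) : R :=
  ((List.finRange N).map fun i => x i ^ f i).prod

/-- `u` is a normal element of `R`: `uR = Ru`. -/
def IsNormalElem {R : Type*} [Ring R] (u : R) : Prop :=
  {y : R | ∃ t : R, y = u * t} = {y : R | ∃ t : R, y = t * u}

/-- `u` is normal in the subset `S` (a subalgebra): `uS = Su`. -/
def NormalIn {R : Type*} [Ring R] (S : Set R) (u : R) : Prop :=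
  {y : R | ∃ b ∈ S, y = u * b} = {y : R | ∃ b ∈ S, y = b * u}

/-- `u ∣ a` within `S`: `a ∈ Su`. -/
def DvdIn {R : Type*} [Ring R] (S : Set R) (u a : R) : Prop :=
  ∃ b ∈ S, a = b * u

/-- `u` is a prime element of the subring corresponding to the subset `S`:
`u ∈ S` is nonzero, normal in `S`, and generates a proper completely prime
ideal of `S`. -/
def IsPrimeElemIn {R : Type*} [Ring R] (S : Set R) (u : R) : Prop :=
  u ∈ S ∧ u ≠ 0 ∧ NormalIn S u ∧ ¬ DvdIn S u 1 ∧
    ∀ a ∈ S, ∀ b ∈ S, DvdIn S u (a * b) → DvdIn S u a ∨ DvdIn S u b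

/-- The data of a CGL extension presentation of length `N` and torus rank `r`:
generators `x₁,…,x_N`, a `ℤʳ`-grading `A` of `R` (encoding the rational torus
action), the degrees `ρ j` of the generators, and the torus elements `h k`. -/
structure CGLData (K : Type*) [Field K] (R : Type*) [Ring R] [Algebra K R]
    (N r : ℕ) where
  x : Fin N → R
  A : (Fin r → ℤ) → Submodule K R
  graded : GradedAlgebra A
  ρ : Fin N → Fin r → ℤ
  h : Fin N → Fin r → Kˣ

variable {K : Type*} [Field K] {R : Type*} [Ring R] [Algebra K R] {N r : ℕ}

/-- The action of the torus element `t ∈ (Kˣ)ʳ` on `R`: `t` acts on the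
homogeneous component of degree `m` by the scalar `tᵐ`. -/
noncomputable def CGLData.act (E : CGLData K R N r) (t : Fin r → Kˣ)
    (a : R) : R :=
  letI := E.graded
  letI : ∀ (m : Fin r → ℤ) (z : ↥(E.A m)), Decidable (z ≠ 0) :=
    fun _ _ => Classical.dec _
  (DirectSum.decompose E.A a).sum fun m z => ((tpow t m : Kˣ) : K) • (z : R)

/-- The subalgebra `R_k` generated by `x_j` for `j < k` (so `R₀ = K` and
`R_N = R`). -/
def CGLData.sub (E : CGLData K R N r) (k : ℕ) : Subalgebra K R :=
  Algebra.adjoin K {y : R | ∃ j : Fin N, (j : ℕ) < k ∧ y = E.x j}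

/-- The skew derivation `δ_k(b) = x_k·b − σ_k(b)·x_k`, where
`σ_k = (h_k ·)`. -/
noncomputable def CGLData.D (E : CGLData K R N r) (k : Fin N) (a : R) : R :=
  E.x k * a - E.act (E.h k) a * E.x k

/-- The conditions making the data `E` a CGL extension presentation:
the ordered monomials in the `x_i` form a `K`-basis of `R` (PBW);
each `x_i` is a nonzero homogeneous element of degree `ρ i`;
for each `k`, `σ_k := (h_k ·)` and `δ_k` map `R_{k-1}` to itself (so that
`R_k = R_{k-1}[x_k; σ_k, δ_k]`, with `σ_k(x_j) = λ_{kj} x_j` for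
`λ_{kj} := h_k^{ρ j}` automatically);
each `δ_k` is locally nilpotent on `R_{k-1}`;
and `λ_k := h_k^{ρ k}` is not a root of unity. -/
structure CGLData.IsCGL (E : CGLData K R N r) : Prop where
  pbw : ∀ a : R, ∃! c : (Fin N → ℕ) →₀ K, a = c.sum fun f t => t • xmon E.x f
  xhom : ∀ i : Fin N, E.x i ∈ E.A (E.ρ i)
  xne : ∀ i : Fin N, E.x i ≠ 0
  sigma_stab : ∀ k : Fin N, ∀ b ∈ E.sub (k : ℕ), E.act (E.h k) b ∈ E.sub (k : ℕ)
  delta_stab : ∀ k : Fin N, ∀ b ∈ E.sub (k : ℕ), E.D k b ∈ E.sub (k : ℕ)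
  delta_nil : ∀ k : Fin N, ∀ b ∈ E.sub (k : ℕ), ∃ n : ℕ, (E.D k)^[n] b = 0
  notroot : ∀ k : Fin N, ∀ n : ℕ, 1 ≤ n → (tpow (E.h k) (E.ρ k)) ^ n ≠ 1

/-- `u` is a homogeneous prime element of the subalgebra of `R` given by the
subset `S`, for the grading of the CGL datum `E`. -/
def CGLData.IsHomogPrimeIn (E : CGLData K R N r) (S : Set R) (u : R) : Prop :=
  IsPrimeElemIn S u ∧ ∃ m : Fin r → ℤ, u ∈ E.A m

/-- `s(j) > k` for the level sets of `μ`: there is no `j'` with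
`j < j' ≤ k` and `μ(j') = μ(j)`. -/
def SGt {N n : ℕ} (μ : Fin N → Fin n) (j k : Fin N) : Prop :=
  ∀ j' : Fin N, j < j' → j' ≤ k → μ j' ≠ μ j

/-- `s(j) = +∞` for the level sets of `μ`. -/
def SInf {N n : ℕ} (μ : Fin N → Fin n) (j : Fin N) : Prop :=
  ∀ j' : Fin N, j < j' → μ j' ≠ μ j

/-- `p(k) = −∞` for the level sets of `μ`. -/
def PInf {N n : ℕ} (μ : Fin N → Fin n) (k : Fin N) : Prop :=
  ∀ j : Fin N, j < k → μ j ≠ μ k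

/-- `p(k) = j` for the level sets of `μ`. -/
def IsPred {N n : ℕ} (μ : Fin N → Fin n) (j k : Fin N) : Prop :=
  j < k ∧ μ j = μ k ∧ ∀ j' : Fin N, j < j' → j' < k → μ j' ≠ μ k

/-- The multiplicatively skewsymmetric extension of the matrix
`λ_{km} = h_k^{ρ m}` (for `m < k`). -/
def CGLData.lam (E : CGLData K R N r) (k m : Fin N) : Kˣ :=
  if m < k then tpow (E.h k) (E.ρ m)
  else if k < m then (tpow (E.h m) (E.ρ k))⁻¹
  else 1

/-- The scalars `α_{kj} = ∏_{m=0}^{O₋(j)} λ_{k,p^m(j)}`; the iterates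
`p^m(j)` run exactly over `{i ≤ j : μ(i) = μ(j)}`. -/
def CGLData.alpha (E : CGLData K R N r) {n : ℕ} (μ : Fin N → Fin n)
    (k j : Fin N) : Kˣ :=
  ∏ m ∈ Finset.univ.filter fun m : Fin N => m ≤ j ∧ μ m = μ j, E.lam k m

/-- The scalars
`q_{kj} = ∏_{i=0}^{O₋(k)} ∏_{m=0}^{O₋(j)} λ_{p^i(k),p^m(j)}`; the iterates
`p^i(k)` run exactly over `{i ≤ k : μ(i) = μ(k)}`. -/
def CGLData.q (E : CGLData K R N r) {n : ℕ} (μ : Fin N → Fin n)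
    (k j : Fin N) : Kˣ :=
  ∏ i ∈ Finset.univ.filter fun i : Fin N => i ≤ k ∧ μ i = μ k,
    ∏ m ∈ Finset.univ.filter fun m : Fin N => m ≤ j ∧ μ m = μ j, E.lam i m

end CGLDefs

section Struct

variable {K : Type*} [Field K] {R : Type*} [Ring R] [Algebra K R] {N r : ℕ}

/-- The data `(μ, d, y)` produced by the structure theorem for the CGL
extension `E`: `μ` is surjective, the `y_k` are defined by the recursion
`y_k = y_{p(k)}·x_k − d_k` (with `y_k = x_k` when `p(k) = −∞`), each `y_k` is
homogeneous, `{y_j : j ≤ k, s(j) > k}` is a complete irredundant list (up to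
scalar multiples) of the homogeneous prime elements of `R_k`, and
`y_k·y_j = q_{kj}·y_j·y_k`. -/
def CGLData.StructData (E : CGLData K R N r) {n : ℕ} (μ : Fin N → Fin n)
    (d y : Fin N → R) : Prop :=
  Function.Surjective μ ∧
  (∀ k : Fin N, PInf μ k → y k = E.x k) ∧
  (∀ k j : Fin N, IsPred μ j k →
    d k ∈ E.sub (k : ℕ) ∧ y k = y j * E.x k - d k) ∧
  (∀ k : Fin N, ∃ m : Fin r → ℤ, y k ∈ E.A m) ∧
  (∀ k : Fin N,
    (∀ j : Fin N, j ≤ k → SGt μ j k →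
      E.IsHomogPrimeIn (E.sub ((k : ℕ) + 1) : Set R) (y j)) ∧
    (∀ j j' : Fin N, j ≤ k → j' ≤ k → SGt μ j k → SGt μ j' k → j ≠ j' →
      ∀ t : Kˣ, y j ≠ (t : K) • y j') ∧
    (∀ p : R, E.IsHomogPrimeIn (E.sub ((k : ℕ) + 1) : Set R) p →
      ∃ j : Fin N, j ≤ k ∧ SGt μ j k ∧ ∃ t : Kˣ, p = (t : K) • y j)) ∧
  (∀ k j : Fin N, y k * y j = ((E.q μ k j : Kˣ) : K) • (y j * y k))

end Struct

section OreExtension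

variable {K : Type*} [Field K] {R : Type*} [Ring R] [Algebra K R]

/-- The `σ`-skew derivation `a ↦ x a - σ(a) x`, as a linear map. -/
def skewDer (x : R) (σ : R ≃ₐ[K] R) : R →ₗ[K] R where
  toFun a := x * a - σ a * x
  map_add' a b := by simp only [map_add]; noncomm_ring
  map_smul' c a := by simp [smul_sub]

theorem skewDer_apply (x : R) (σ : R ≃ₐ[K] R) (a : R) :
    skewDer x σ a = x * a - σ a * x := rfl

theorem skewDer_mul (x : R) (σ : R ≃ₐ[K] R) (a b : R) :
    skewDer x σ (a * b) = skewDer x σ a * b + σ a * skewDer x σ b := by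
  simp only [skewDer_apply, map_mul]; noncomm_ring

theorem skewDer_comm {x : R} {σ : R ≃ₐ[K] R} {q : K} (hq : q ≠ 0) (hx : σ x = q • x) (a : R) :
    skewDer x σ (σ a) = q⁻¹ • σ (skewDer x σ a) := by
  simp only [skewDer_apply, map_sub, map_mul, hx, smul_sub, smul_mul_assoc, mul_smul_comm,
    inv_smul_smul₀ hq]

theorem skewDer_iterate_comm {x : R} {σ : R ≃ₐ[K] R} {q : K} (hq : q ≠ 0) (hx : σ x = q • x)
    (n : ℕ) (a : R) :
    (skewDer x σ)^[n] (σ a) = (q⁻¹) ^ n • σ ((skewDer x σ)^[n] a) := by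
  induction n with
  | zero => simp
  | succ n ih =>
    rw [Function.iterate_succ_apply', ih, map_smul, skewDer_comm hq hx, smul_smul,
      Function.iterate_succ_apply', pow_succ]

/-- The `q`-integer `1 + q + ⋯ + q^{n-1}`. -/
def qInt (q : K) (n : ℕ) : K := ∑ j ∈ Finset.range n, q ^ j

/-- The `q`-factorial. -/
def qFact (q : K) (n : ℕ) : K := ∏ j ∈ Finset.range n, qInt q (j + 1)

theorem qInt_add (q : K) (n m : ℕ) : qInt q (n + m) = qInt q n + q ^ n * qInt q m := by
  simp only [qInt, Finset.sum_range_add, Finset.mul_sum, pow_add]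

theorem qFact_succ (q : K) (n : ℕ) : qFact q (n + 1) = qFact q n * qInt q (n + 1) :=
  Finset.prod_range_succ _ _

theorem qFact_ne_zero {q : K} (hq : ∀ n : ℕ, 1 ≤ n → q ^ n ≠ 1) (n : ℕ) : qFact q n ≠ 0 := by
  refine Finset.prod_ne_zero_iff.2 fun j _ h => hq (j + 1) (by omega) ?_
  have := mul_geom_sum q (j + 1)
  rw [show ∑ i ∈ Finset.range (j + 1), q ^ i = 0 from h, mul_zero] at this
  exact (sub_eq_zero.1 this.symm)

/-- The top term of the `q`-Leibniz rule for a skew derivation. -/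
theorem skewDer_iterate_mul {x : R} {σ : R ≃ₐ[K] R} {q : K} (hq : q ≠ 0) (hx : σ x = q • x)
    (n m : ℕ) (c v : R) (hc : (skewDer x σ)^[n + 1] c = 0) (hv : (skewDer x σ)^[m + 1] v = 0) :
    (qFact q⁻¹ n * qFact q⁻¹ m) • (skewDer x σ)^[n + m] (c * v) =
      qFact q⁻¹ (n + m) • (σ^[m] ((skewDer x σ)^[n] c) * (skewDer x σ)^[m] v) := by
  have iter_add : ∀ (k : ℕ) (a b : R), (skewDer x σ)^[k] (a + b) =
      (skewDer x σ)^[k] a + (skewDer x σ)^[k] b := fun k a b => by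
    simp only [← Module.End.coe_pow, map_add]
  have iter_zero : ∀ k : ℕ, (skewDer x σ)^[k] (0 : R) = 0 := fun k => by
    simp only [← Module.End.coe_pow, map_zero]
  have σ_smul : ∀ (k : ℕ) (t : K) (a : R), σ^[k] (t • a) = t • σ^[k] a := fun k t a => by
    induction k with
    | zero => rfl
    | succ k ih => rw [Function.iterate_succ_apply', ih, map_smul, Function.iterate_succ_apply']
  induction hs : n + m generalizing n m c v with
  | zero =>
    obtain ⟨rfl, rfl⟩ : n = 0 ∧ m = 0 := by omega
    simp [qFact]
  | succ s ih =>
    rw [Function.iterate_succ_apply, skewDer_mul, iter_add, smul_add, qFact_succ, ← hs, qInt_add]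
    have h1 : (qFact q⁻¹ n * qFact q⁻¹ m) • (skewDer x σ)^[s] (skewDer x σ c * v) =
        (qFact q⁻¹ s * qInt q⁻¹ n) • (σ^[m] ((skewDer x σ)^[n] c) * (skewDer x σ)^[m] v) := by
      cases n with
      | zero =>
        have : skewDer x σ c = 0 := hc
        simp [this, iter_zero, qInt]
      | succ n =>
        have := ih n m (skewDer x σ c) v hc hv (by omega)
        rw [qFact_succ, mul_right_comm, mul_comm, mul_smul, this, smul_smul, mul_comm]
        rfl
    have h2 : (qFact q⁻¹ n * qFact q⁻¹ m) • (skewDer x σ)^[s] (σ c * skewDer x σ v) =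
        (qFact q⁻¹ s * (q⁻¹ ^ n * qInt q⁻¹ m)) •
          (σ^[m] ((skewDer x σ)^[n] c) * (skewDer x σ)^[m] v) := by
      cases m with
      | zero =>
        have : skewDer x σ v = 0 := hv
        simp [this, iter_zero, qInt]
      | succ m =>
        have := ih n m (σ c) (skewDer x σ v)
          (by rw [skewDer_iterate_comm hq hx, hc, map_zero, smul_zero]) hv (by omega)
        rw [qFact_succ, ← mul_assoc, mul_comm, mul_smul, this, skewDer_iterate_comm hq hx,
          σ_smul, smul_mul_assoc, smul_smul, smul_smul]
        rw [show qInt q⁻¹ (m + 1) * qFact q⁻¹ s * q⁻¹ ^ n =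
          qFact q⁻¹ s * (q⁻¹ ^ n * qInt q⁻¹ (m + 1)) by ring]
        rfl
    rw [h1, h2, ← add_smul, mul_add]

/-- The span of the elements `a xⁱ` with `a ∈ S` and `i < n`. -/
def skewLT (S : Subalgebra K R) (x : R) (n : ℕ) : Submodule K R :=
  Submodule.span K {u | ∃ a ∈ S, ∃ i < n, u = a * x ^ i}

/-- `T = S[x; σ, δ]` is an Ore extension inside `R`, where `σ` is the restriction of an
automorphism of `R` scaling `x` by `q`, which is not a root of unity, and `δ` is locally
nilpotent. -/
structure IsOreExt (S T : Subalgebra K R) (x : R) (σ : R ≃ₐ[K] R) (q : K) : Prop where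
  mem_iff : ∀ u, u ∈ T ↔ ∃ n, u ∈ skewLT S x n
  stab : ∀ a, σ a ∈ S ↔ a ∈ S
  der : ∀ a ∈ S, skewDer x σ a ∈ S
  coeff : ∃ P : ℕ → R →ₗ[K] R, ∀ a ∈ S, ∀ i j, P i (a * x ^ j) = if i = j then a else 0
  nil : ∀ a ∈ S, ∃ n, (skewDer x σ)^[n] a = 0
  map_x : σ x = q • x
  q_ne : q ≠ 0
  notroot : ∀ n : ℕ, 1 ≤ n → q ^ n ≠ 1

/-- `S` has no zero divisors. -/
def NoZeroDivIn (S : Subalgebra K R) : Prop :=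
  ∀ a ∈ S, ∀ b ∈ S, a * b = 0 → a = 0 ∨ b = 0

/-- The units of `S` are scalars. -/
def UnitsScalar (S : Subalgebra K R) : Prop :=
  ∀ a ∈ S, ∀ b ∈ S, a * b = 1 → ∃ t : K, a = algebraMap K R t

section skewLT

variable {S : Subalgebra K R} {x : R} {n m : ℕ} {u v a : R}

theorem mul_pow_mem_skewLT (ha : a ∈ S) (h : m < n) : a * x ^ m ∈ skewLT S x n :=
  Submodule.subset_span ⟨a, ha, m, h, rfl⟩

theorem skewLT_mono (h : n ≤ m) : skewLT S x n ≤ skewLT S x m :=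
  Submodule.span_mono fun _ ⟨a, ha, i, hi, e⟩ => ⟨a, ha, i, hi.trans_le h, e⟩

/-- To prove that a linear image of `skewLT` lies in a submodule, check it on the spanning set. -/
theorem skewLT_map_mem (f : R →ₗ[K] R) (M : Submodule K R)
    (h : ∀ a ∈ S, ∀ i < n, f (a * x ^ i) ∈ M) (hu : u ∈ skewLT S x n) : f u ∈ M := by
  have : skewLT S x n ≤ M.comap f := by
    refine Submodule.span_le.2 ?_
    rintro _ ⟨a, ha, i, hi, rfl⟩
    exact h a ha i hi
  exact this hu

theorem mul_mem_skewLT_left (ha : a ∈ S) (hu : u ∈ skewLT S x n) : a * u ∈ skewLT S x n := by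
  refine skewLT_map_mem (LinearMap.mulLeft K a) _ (fun b hb i hi => ?_) hu
  rw [LinearMap.mulLeft_apply, ← mul_assoc]
  exact mul_pow_mem_skewLT (S.mul_mem ha hb) hi

theorem mul_pow_mem_skewLT_right (m : ℕ) (hu : u ∈ skewLT S x n) :
    u * x ^ m ∈ skewLT S x (n + m) := by
  refine skewLT_map_mem (LinearMap.mulRight K (x ^ m)) _ (fun b hb i hi => ?_) hu
  rw [LinearMap.mulRight_apply, mul_assoc, ← pow_add]
  exact mul_pow_mem_skewLT hb (by omega)

theorem mem_skewLT_one (ha : a ∈ S) : a ∈ skewLT S x 1 := by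
  simpa using mul_pow_mem_skewLT (x := x) ha Nat.zero_lt_one

theorem skewLT_zero_eq (hu : u ∈ skewLT S x 0) : u = 0 := by
  simpa [skewLT] using hu

theorem skewLT_succ_top (hu : u ∈ skewLT S x (n + 1)) :
    ∃ a ∈ S, u - a * x ^ n ∈ skewLT S x n := by
  induction hu using Submodule.span_induction with
  | mem u h =>
    obtain ⟨a, ha, i, hi, rfl⟩ := h
    rcases Nat.lt_succ_iff_lt_or_eq.1 hi with hi | rfl
    · exact ⟨0, S.zero_mem, by simpa using mul_pow_mem_skewLT ha hi⟩
    · exact ⟨a, ha, by simp⟩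
  | zero => exact ⟨0, S.zero_mem, by simp⟩
  | add u v _ _ h1 h2 =>
    obtain ⟨a, ha, h1⟩ := h1
    obtain ⟨b, hb, h2⟩ := h2
    refine ⟨a + b, S.add_mem ha hb, ?_⟩
    convert Submodule.add_mem _ h1 h2 using 1
    noncomm_ring
  | smul t u _ h =>
    obtain ⟨a, ha, h⟩ := h
    refine ⟨t • a, S.smul_mem ha t, ?_⟩
    convert Submodule.smul_mem _ t h using 1
    rw [smul_sub, smul_mul_assoc]

theorem skewLT_succ_bot (hu : u ∈ skewLT S x (n + 1)) :
    ∃ a ∈ S, ∃ v ∈ skewLT S x n, u = a + v * x := by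
  induction hu using Submodule.span_induction with
  | mem u h =>
    obtain ⟨a, ha, i, hi, rfl⟩ := h
    cases i with
    | zero => exact ⟨a, ha, 0, Submodule.zero_mem _, by simp⟩
    | succ i =>
      exact ⟨0, S.zero_mem, a * x ^ i, mul_pow_mem_skewLT ha (by omega), by
        rw [zero_add, pow_succ, mul_assoc]⟩
  | zero => exact ⟨0, S.zero_mem, 0, Submodule.zero_mem _, by simp⟩
  | add u v _ _ h1 h2 =>
    obtain ⟨a, ha, w, hw, rfl⟩ := h1
    obtain ⟨b, hb, z, hz, rfl⟩ := h2
    exact ⟨a + b, S.add_mem ha hb, w + z, Submodule.add_mem _ hw hz, by noncomm_ring⟩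
  | smul t u _ h =>
    obtain ⟨a, ha, w, hw, rfl⟩ := h
    exact ⟨t • a, S.smul_mem ha t, t • w, Submodule.smul_mem _ t hw, by
      rw [smul_add, smul_mul_assoc]⟩

theorem x_mul_mem_skewLT {σ : R ≃ₐ[K] R} (hσ : ∀ a ∈ S, σ a ∈ S)
    (hδ : ∀ a ∈ S, skewDer x σ a ∈ S) (hu : u ∈ skewLT S x n) : x * u ∈ skewLT S x (n + 1) := by
  refine skewLT_map_mem (LinearMap.mulLeft K x) _ (fun b hb i hi => ?_) hu
  have : x * (b * x ^ i) = σ b * x ^ (i + 1) + skewDer x σ b * x ^ i := by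
    rw [skewDer_apply, pow_succ']; noncomm_ring
  rw [LinearMap.mulLeft_apply, this]
  exact Submodule.add_mem _ (mul_pow_mem_skewLT (hσ b hb) (by omega))
    (mul_pow_mem_skewLT (hδ b hb) (by omega))

theorem mul_mem_skewLT {σ : R ≃ₐ[K] R} (hσ : ∀ a ∈ S, σ a ∈ S)
    (hδ : ∀ a ∈ S, skewDer x σ a ∈ S) (hu : u ∈ skewLT S x n) (hv : v ∈ skewLT S x (m + 1)) :
    u * v ∈ skewLT S x (n + m) := by
  refine skewLT_map_mem (LinearMap.mulRight K v) _ (fun b hb i hi => ?_) hu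
  rw [LinearMap.mulRight_apply, mul_assoc]
  refine mul_mem_skewLT_left hb (skewLT_mono (n := m + 1 + i) (by omega) ?_)
  clear hi
  induction i with
  | zero => simpa using hv
  | succ i ih =>
    rw [pow_succ', mul_assoc]
    exact x_mul_mem_skewLT hσ hδ ih

end skewLT

/-- `u` has degree at most `n` in `x`, with coefficient `a` of `xⁿ`. -/
def HasLead (S : Subalgebra K R) (x : R) (n : ℕ) (a u : R) : Prop :=
  a ∈ S ∧ u - a * x ^ n ∈ skewLT S x n

namespace IsOreExt

variable {S T : Subalgebra K R} {x : R} {σ : R ≃ₐ[K] R} {q : K} (H : IsOreExt S T x σ q)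
include H

theorem le : S ≤ T := fun _ ha => (H.mem_iff _).2 ⟨1, mem_skewLT_one ha⟩

theorem x_mem : x ∈ T := (H.mem_iff _).2 ⟨2, by
  simpa using mul_pow_mem_skewLT (S := S) (x := x) S.one_mem Nat.one_lt_two⟩

theorem eq_zero_of_mul_pow_mem {n : ℕ} {a : R} (ha : a ∈ S) (h : a * x ^ n ∈ skewLT S x n) :
    a = 0 := by
  obtain ⟨P, hP⟩ := H.coeff
  have : P n (a * x ^ n) ∈ (⊥ : Submodule K R) := by
    refine skewLT_map_mem (P n) ⊥ (fun b hb i hi => ?_) h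
    rw [hP b hb, if_neg (by omega)]
    exact Submodule.zero_mem _
  rw [hP a ha, if_pos rfl] at this
  exact this

theorem eq_zero_of_eq_mul {a v : R} (ha : a ∈ S) (hv : v ∈ T) (h : a = v * x) : a = 0 := by
  obtain ⟨P, hP⟩ := H.coeff
  obtain ⟨n, hv⟩ := (H.mem_iff v).1 hv
  have : P 0 (v * x) ∈ (⊥ : Submodule K R) := by
    refine skewLT_map_mem (P 0 ∘ₗ LinearMap.mulRight K x) ⊥ (fun b hb i hi => ?_) hv
    rw [LinearMap.comp_apply, LinearMap.mulRight_apply, mul_assoc, ← pow_succ, hP b hb,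
      if_neg (by omega)]
    exact Submodule.zero_mem _
  rw [← h] at this
  have h0 := hP a ha 0 0
  rw [pow_zero, mul_one, if_pos rfl] at h0
  rw [h0] at this
  exact this

theorem lead_unique_coeff {n : ℕ} {a b u : R} (ha : HasLead S x n a u) (hb : HasLead S x n b u) :
    a = b := by
  refine sub_eq_zero.1 (H.eq_zero_of_mul_pow_mem (n := n) (S.sub_mem ha.1 hb.1) ?_)
  convert Submodule.sub_mem _ hb.2 ha.2 using 1
  noncomm_ring

omit H in
theorem mem_of_lead {n : ℕ} {a u : R} (ha : HasLead S x n a u) : u ∈ skewLT S x (n + 1) := by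
  have := Submodule.add_mem _ (skewLT_mono (Nat.le_succ n) ha.2)
    (mul_pow_mem_skewLT (x := x) ha.1 (Nat.lt_succ_self n))
  simpa using this

theorem lead_unique_deg {n m : ℕ} {a b u : R} (ha : HasLead S x n a u) (hb : HasLead S x m b u)
    (ha0 : a ≠ 0) (hb0 : b ≠ 0) : n = m := by
  have key : ∀ {n m : ℕ} {a b : R}, HasLead S x n a u → HasLead S x m b u → b ≠ 0 → ¬ n < m := by
    intro n m a b ha hb hb0 h
    refine hb0 (H.eq_zero_of_mul_pow_mem (n := m) hb.1 ?_)
    convert Submodule.sub_mem _ (skewLT_mono h (mem_of_lead ha)) hb.2 using 1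
    noncomm_ring
  have := key ha hb hb0
  have := key hb ha ha0
  omega

theorem exists_lead {u : R} (hu : u ∈ T) (h0 : u ≠ 0) : ∃ n a, a ≠ 0 ∧ HasLead S x n a u := by
  obtain ⟨n, hn⟩ := (H.mem_iff u).1 hu
  induction n with
  | zero => exact absurd (skewLT_zero_eq hn) h0
  | succ n ih =>
    obtain ⟨a, ha, h⟩ := skewLT_succ_top hn
    rcases eq_or_ne a 0 with rfl | ha0
    · exact ih (by simpa using h)
    · exact ⟨n, a, ha0, ha, h⟩

omit H in
theorem lead_of_mem {a : R} (ha : a ∈ S) : HasLead S x 0 a a := ⟨ha, by simp⟩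

omit H in
theorem mem_of_lead_zero {a u : R} (h : HasLead S x 0 a u) : u = a := by
  simpa [sub_eq_zero] using skewLT_zero_eq h.2

theorem iterate_mem (n : ℕ) {a : R} (ha : a ∈ S) : σ^[n] a ∈ S := by
  induction n with
  | zero => exact ha
  | succ n ih => rw [Function.iterate_succ_apply']; exact (H.stab _).2 ih

theorem exists_iterate_eq (n : ℕ) {a : R} (ha : a ∈ S) : ∃ b ∈ S, σ^[n] b = a := by
  induction n with
  | zero => exact ⟨a, ha, rfl⟩
  | succ n ih =>
    obtain ⟨b, hb, rfl⟩ := ih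
    refine ⟨σ.symm b, (H.stab _).1 (by simpa using hb), ?_⟩
    rw [Function.iterate_succ_apply, AlgEquiv.apply_symm_apply]

theorem pow_mul_sub_mem (n : ℕ) {b : R} (hb : b ∈ S) :
    x ^ n * b - σ^[n] b * x ^ n ∈ skewLT S x n := by
  induction n with
  | zero => simp
  | succ n ih =>
    have h1 := x_mul_mem_skewLT (fun a => (H.stab a).2) H.der ih
    have h2 : skewDer x σ (σ^[n] b) * x ^ n ∈ skewLT S x (n + 1) :=
      mul_pow_mem_skewLT (H.der _ (H.iterate_mem n hb)) (Nat.lt_succ_self n)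
    convert Submodule.add_mem _ h1 h2 using 1
    rw [Function.iterate_succ_apply', skewDer_apply, pow_succ']
    noncomm_ring

theorem lead_mul {n m : ℕ} {a b u v : R} (ha : HasLead S x n a u) (hb : HasLead S x m b v) :
    HasLead S x (n + m) (a * σ^[n] b) (u * v) := by
  refine ⟨S.mul_mem ha.1 (H.iterate_mem n hb.1), ?_⟩
  have hσ := fun a => (H.stab a).2
  have h1 := mul_mem_skewLT hσ H.der ha.2 (mem_of_lead hb)
  have h3 := mul_mem_skewLT_left ha.1 (mul_pow_mem_skewLT_right m (H.pow_mul_sub_mem n hb.1))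
  have h2 : a * x ^ n * (v - b * x ^ m) ∈ skewLT S x (n + m) := by
    rcases m with _ | m
    · rw [skewLT_zero_eq hb.2, mul_zero]; exact Submodule.zero_mem _
    · have := mul_mem_skewLT hσ H.der (mul_pow_mem_skewLT (x := x) ha.1 (Nat.lt_succ_self n)) hb.2
      rwa [Nat.succ_add_eq_add_succ] at this
  convert Submodule.add_mem _ (Submodule.add_mem _ h1 h2) h3 using 1
  rw [pow_add]
  noncomm_ring

omit H in
theorem iterate_ne_zero (n : ℕ) {a : R} (ha : a ≠ 0) : σ^[n] a ≠ 0 := by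
  induction n with
  | zero => exact ha
  | succ n ih => rw [Function.iterate_succ_apply']; simpa using ih

theorem lead_mul_ne (hS : NoZeroDivIn S) {n m : ℕ} {a b u v : R} (ha : HasLead S x n a u)
    (hb : HasLead S x m b v) (ha0 : a ≠ 0) (hb0 : b ≠ 0) : a * σ^[n] b ≠ 0 := fun h =>
  (hS _ ha.1 _ (H.iterate_mem n hb.1) h).elim ha0 (iterate_ne_zero n hb0)

theorem noZeroDiv (hS : NoZeroDivIn S) : NoZeroDivIn T := by
  intro u hu v hv huv
  by_contra! h
  obtain ⟨n, a, ha0, ha⟩ := H.exists_lead hu h.1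
  obtain ⟨m, b, hb0, hb⟩ := H.exists_lead hv h.2
  have h1 := H.lead_mul ha hb
  have h2 : HasLead S x (n + m) 0 (u * v) := ⟨S.zero_mem, by simp [huv]⟩
  exact H.lead_mul_ne hS ha hb ha0 hb0 (H.lead_unique_coeff h1 h2)

theorem unitsScalar (hS : NoZeroDivIn S) (hU : UnitsScalar S) : UnitsScalar T := by
  intro u hu v hv huv
  rcases subsingleton_or_nontrivial R with hR | hR
  · exact ⟨0, Subsingleton.elim _ _⟩
  have hu0 : u ≠ 0 := by rintro rfl; simp at huv
  have hv0 : v ≠ 0 := by rintro rfl; simp at huv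
  obtain ⟨n, a, ha0, ha⟩ := H.exists_lead hu hu0
  obtain ⟨m, b, hb0, hb⟩ := H.exists_lead hv hv0
  have h1 := H.lead_mul ha hb
  rw [huv] at h1
  have := H.lead_unique_deg h1 (lead_of_mem S.one_mem) (H.lead_mul_ne hS ha hb ha0 hb0) one_ne_zero
  obtain ⟨rfl, rfl⟩ : n = 0 ∧ m = 0 := by omega
  obtain rfl := mem_of_lead_zero ha
  obtain rfl := mem_of_lead_zero hb
  exact hU _ ha.1 _ hb.1 huv

omit H in
theorem exists_last_iterate {f : R → R} {a : R} (ha : a ≠ 0) (h : ∃ n, f^[n] a = 0) :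
    ∃ n, f^[n] a ≠ 0 ∧ f^[n + 1] a = 0 := by
  classical
  have hpos : Nat.find h ≠ 0 := fun h0 => ha (by simpa [h0] using Nat.find_spec h)
  refine ⟨Nat.find h - 1, Nat.find_min h (by omega), ?_⟩
  rw [Nat.sub_add_cancel (Nat.one_le_iff_ne_zero.2 hpos)]
  exact Nat.find_spec h

theorem iterate_der_mem (n : ℕ) {a : R} (ha : a ∈ S) : (skewDer x σ)^[n] a ∈ S := by
  induction n with
  | zero => exact ha
  | succ n ih => rw [Function.iterate_succ_apply']; exact H.der _ ih

/-- A nonzero element cannot divide its image under a locally nilpotent skew derivation unless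
the quotient vanishes. -/
theorem eq_zero_of_der_eq_mul (hS : NoZeroDivIn S) {c v : R} (hc : c ∈ S) (hv : v ∈ S)
    (hv0 : v ≠ 0) (h : skewDer x σ v = c * v) : c = 0 := by
  by_contra hc0
  obtain ⟨n, hn, hn'⟩ := exists_last_iterate hc0 (H.nil c hc)
  obtain ⟨m, hm, hm'⟩ := exists_last_iterate hv0 (H.nil v hv)
  have key := skewDer_iterate_mul H.q_ne H.map_x n m c v hn' hm'
  have h0 : (skewDer x σ)^[n + m] (c * v) = 0 := by
    rw [← h, ← Function.iterate_succ_apply, Nat.succ_eq_add_one, add_assoc,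
      Function.iterate_add_apply, hm', ← Module.End.coe_pow, map_zero]
  have hroot : ∀ n : ℕ, 1 ≤ n → q⁻¹ ^ n ≠ 1 := fun n hn h => H.notroot n hn (by
    rwa [inv_pow, inv_eq_one] at h)
  rw [h0, smul_zero, eq_comm, smul_eq_zero] at key
  rcases key with key | key
  · exact qFact_ne_zero hroot _ key
  · rcases hS _ (H.iterate_mem m (H.iterate_der_mem n hc)) _ (H.iterate_der_mem m hv) key with h | h
    · exact iterate_ne_zero m hn h
    · exact hm h

section Normal

variable {n : ℕ} {u w : R} (hS : NoZeroDivIn S) (hu : HasLead S x n w u) (hw : w ≠ 0)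
include hS hu hw

omit hS in
theorem ne_zero_of_lead : u ≠ 0 := by
  rintro rfl
  exact hw (H.lead_unique_coeff hu ⟨S.zero_mem, by simp⟩)

theorem mem_of_mul_eq_left {a c : R} (ha : a ∈ S) (hc : c ∈ T) (h : u * a = c * u) :
    c ∈ S ∧ c * w = w * σ^[n] a := by
  have huT : u ∈ T := (H.mem_iff u).2 ⟨_, mem_of_lead hu⟩
  have hu0 := H.ne_zero_of_lead hu hw
  rcases eq_or_ne c 0 with rfl | hc0
  · rw [zero_mul] at h
    obtain rfl := (H.noZeroDiv hS _ huT _ (H.le ha) h).resolve_left hu0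
    have : σ^[n] (0 : R) = 0 := Function.iterate_fixed (map_zero σ) n
    exact ⟨S.zero_mem, by rw [this, zero_mul, mul_zero]⟩
  have ha0 : a ≠ 0 := by
    rintro rfl
    rw [mul_zero] at h
    exact (H.noZeroDiv hS _ hc _ huT h.symm).elim hc0 hu0
  obtain ⟨i, e, he0, he⟩ := H.exists_lead hc hc0
  have h1 := H.lead_mul he hu
  have h2 := H.lead_mul hu (lead_of_mem ha)
  rw [← h] at h1
  have := H.lead_unique_deg h1 h2 (H.lead_mul_ne hS he hu he0 hw)
    (H.lead_mul_ne hS hu (lead_of_mem ha) hw ha0)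
  obtain rfl : i = 0 := by omega
  obtain rfl := mem_of_lead_zero he
  rw [Nat.zero_add] at h1
  exact ⟨he.1, H.lead_unique_coeff h1 h2⟩

theorem mem_of_mul_eq_right {a c : R} (ha : a ∈ S) (hc : c ∈ T) (h : a * u = u * c) :
    c ∈ S ∧ a * w = w * σ^[n] c := by
  have huT : u ∈ T := (H.mem_iff u).2 ⟨_, mem_of_lead hu⟩
  have hu0 := H.ne_zero_of_lead hu hw
  rcases eq_or_ne c 0 with rfl | hc0
  · rw [mul_zero] at h
    obtain rfl := (H.noZeroDiv hS _ (H.le ha) _ huT h).resolve_right hu0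
    have : σ^[n] (0 : R) = 0 := Function.iterate_fixed (map_zero σ) n
    exact ⟨S.zero_mem, by rw [this, zero_mul, mul_zero]⟩
  have ha0 : a ≠ 0 := by
    rintro rfl
    rw [zero_mul] at h
    exact (H.noZeroDiv hS _ huT _ hc h.symm).elim hu0 hc0
  obtain ⟨i, e, he0, he⟩ := H.exists_lead hc hc0
  have h1 := H.lead_mul hu he
  have h2 := H.lead_mul (lead_of_mem ha) hu
  rw [← h] at h1
  have := H.lead_unique_deg h1 h2 (H.lead_mul_ne hS hu he hw he0)
    (H.lead_mul_ne hS (lead_of_mem ha) hu ha0 hw)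
  obtain rfl : i = 0 := by omega
  obtain rfl := mem_of_lead_zero he
  rw [Nat.zero_add] at h2
  exact ⟨he.1, (H.lead_unique_coeff h1 h2).symm⟩

end Normal

omit H in
theorem mul_right_cancel_in {T : Subalgebra K R} (hT : NoZeroDivIn T) {a b c : R} (ha : a ∈ T)
    (hb : b ∈ T) (hc : c ∈ T) (hc0 : c ≠ 0) (h : a * c = b * c) : a = b :=
  sub_eq_zero.1 ((hT _ (T.sub_mem ha hb) _ hc (by rw [sub_mul, h, sub_self])).resolve_right hc0)

omit H in
theorem mul_left_cancel_in {T : Subalgebra K R} (hT : NoZeroDivIn T) {a b c : R} (ha : a ∈ T)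
    (hb : b ∈ T) (hc : c ∈ T) (hc0 : c ≠ 0) (h : c * a = c * b) : a = b :=
  sub_eq_zero.1 ((hT _ hc _ (T.sub_mem ha hb) (by rw [mul_sub, h, sub_self])).resolve_left hc0)

theorem mem_of_mem_skewLT {n : ℕ} {u : R} (hu : u ∈ skewLT S x n) : u ∈ T := (H.mem_iff u).2 ⟨n, hu⟩

theorem eq_zero_of_mul_x {u : R} (hu : u ∈ T) (h : u * x = 0) : u = 0 := by
  obtain ⟨n, hn⟩ := (H.mem_iff u).1 hu
  by_contra hu0
  obtain ⟨n, a, ha0, ha⟩ := H.exists_lead hu hu0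
  refine ha0 (H.eq_zero_of_mul_pow_mem (n := n + 1) ha.1 ?_)
  have := mul_pow_mem_skewLT_right 1 (Submodule.neg_mem _ ha.2)
  convert this using 1
  rw [pow_succ, pow_one, neg_mul, sub_mul, h, mul_assoc]
  noncomm_ring

/-- If `u x = (a x + b) u` with `a` a nonzero scalar, then `b = 0`. -/
theorem const_eq_zero (hS : NoZeroDivIn S) {a : K} (ha : a ≠ 0) {b : R} (hb : b ∈ S) (n : ℕ)
    {u : R} (hu : u ∈ skewLT S x n) (hu0 : u ≠ 0) (h : u * x = (a • x + b) * u) : b = 0 := by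
  induction n generalizing u with
  | zero => exact absurd (skewLT_zero_eq hu) hu0
  | succ n ih =>
    obtain ⟨c, hc, v, hv, rfl⟩ := skewLT_succ_bot hu
    have hvT := H.mem_of_mem_skewLT hv
    rcases eq_or_ne c 0 with rfl | hc0
    · rw [zero_add] at h hu0
      refine ih hv (by rintro rfl; simp at hu0) (sub_eq_zero.1 (H.eq_zero_of_mul_x ?_ ?_))
      · exact T.sub_mem (T.mul_mem hvT H.x_mem) (T.mul_mem (T.add_mem (T.smul_mem H.x_mem a)
          (H.le hb)) hvT)
      · rw [sub_mul, h]; noncomm_ring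
    · have h1 : a • skewDer x σ c + b * c = 0 := by
        refine H.eq_zero_of_eq_mul (S.add_mem (S.smul_mem (H.der c hc) a) (S.mul_mem hb hc))
          (v := c + v * x - a • σ c - (a • x + b) * v) ?_ ?_
        · refine T.sub_mem (T.sub_mem (T.add_mem (H.le hc) (T.mul_mem hvT H.x_mem))
            (T.smul_mem (H.le ((H.stab c).2 hc)) a)) (T.mul_mem (T.add_mem (T.smul_mem H.x_mem a)
            (H.le hb)) hvT)
        · rw [sub_mul, sub_mul, h, skewDer_apply, smul_sub, add_mul, mul_add, smul_mul_assoc,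
            smul_mul_assoc]
          noncomm_ring
      have h2 : -(a⁻¹ • b) = 0 := by
        refine H.eq_zero_of_der_eq_mul hS (S.neg_mem (S.smul_mem hb _)) hc hc0 ?_
        rw [neg_mul, smul_mul_assoc, ← neg_eq_of_add_eq_zero_right h1, smul_neg, neg_neg,
          inv_smul_smul₀ ha]
      simpa [ha] using h2

/-- A nonzero normal element of `S[x; σ, δ]` has a normal leading coefficient, commutes with `x`
up to a scalar, and commutes up to scalars with those `σ`-eigenvectors in `S` with which its
leading coefficient commutes up to a scalar. -/
theorem normal_lead (hS : NoZeroDivIn S) (hU : UnitsScalar S) {u : R} (hu : u ∈ T) (hu0 : u ≠ 0)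
    (hl : ∀ a ∈ T, ∃ b ∈ T, u * a = b * u) (hr : ∀ a ∈ T, ∃ b ∈ T, a * u = u * b) :
    ∃ w ∈ S, w ≠ 0 ∧ (∀ a ∈ S, ∃ b ∈ S, w * a = b * w) ∧ (∀ a ∈ S, ∃ b ∈ S, a * w = w * b) ∧
      (∀ y ∈ S, ∀ s t : Kˣ, σ y = (s : K) • y → w * y = (t : K) • (y * w) →
        ∃ t' : Kˣ, u * y = (t' : K) • (y * u)) ∧
      ∃ t : Kˣ, u * x = (t : K) • (x * u) := by
  have hT := H.noZeroDiv hS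
  obtain ⟨n, w, hw0, hw⟩ := H.exists_lead hu hu0
  refine ⟨w, hw.1, hw0, fun a ha => ?_, fun a ha => ?_, fun y hy s t hs ht => ?_, ?_⟩
  · obtain ⟨a', ha', rfl⟩ := H.exists_iterate_eq n ha
    obtain ⟨c, hc, h⟩ := hl a' (H.le ha')
    obtain ⟨hc, h⟩ := H.mem_of_mul_eq_left hS hw hw0 ha' hc h
    exact ⟨c, hc, h.symm⟩
  · obtain ⟨c, hc, h⟩ := hr a (H.le ha)
    obtain ⟨hc, h⟩ := H.mem_of_mul_eq_right hS hw hw0 ha hc h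
    exact ⟨_, H.iterate_mem n hc, h⟩
  · obtain ⟨c, hc, h⟩ := hl y (H.le hy)
    obtain ⟨hc, h'⟩ := H.mem_of_mul_eq_left hS hw hw0 hy hc h
    have hsn : ∀ n : ℕ, σ^[n] y = ((s ^ n : Kˣ) : K) • y := fun n => by
      induction n with
      | zero => simp
      | succ n ih =>
        rw [Function.iterate_succ_apply', ih, map_smul, hs, smul_smul, ← Units.val_mul, ← pow_succ]
    refine ⟨s ^ n * t, ?_⟩
    have : c = ((s ^ n * t : Kˣ) : K) • y := by
      refine mul_right_cancel_in hS hc (S.smul_mem hy _) hw.1 hw0 ?_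
      rw [h', hsn, mul_smul_comm, ht, smul_smul, smul_mul_assoc, Units.val_mul]
    rw [h, this, smul_mul_assoc]
  · have hlx : HasLead S x 1 1 x := ⟨S.one_mem, by simp⟩
    have hx0 : x ≠ 0 := by
      rintro hx
      have hR : (1 : R) ≠ 0 := fun h => hu0 (by rw [← one_mul u, h, zero_mul])
      exact H.ne_zero_of_lead hlx hR hx
    have hR : (1 : R) ≠ 0 := fun h => hu0 (by rw [← one_mul u, h, zero_mul])
    obtain ⟨c, hc, h⟩ := hl x H.x_mem
    obtain ⟨c', hc', h'⟩ := hr x H.x_mem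
    have hc0 : c ≠ 0 := by
      rintro rfl
      rw [zero_mul] at h
      exact (hT _ hu _ H.x_mem h).elim hu0 hx0
    have hc'0 : c' ≠ 0 := by
      rintro rfl
      rw [mul_zero] at h'
      exact (hT _ H.x_mem _ hu h').elim hx0 hu0
    obtain ⟨i, a, ha0, ha⟩ := H.exists_lead hc hc0
    obtain ⟨j, a', ha'0, ha'⟩ := H.exists_lead hc' hc'0
    have hi : i = 1 := by
      have h1 := H.lead_mul ha hw
      rw [← h] at h1
      have := H.lead_unique_deg h1 (H.lead_mul hw hlx) (H.lead_mul_ne hS ha hw ha0 hw0)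
        (H.lead_mul_ne hS hw hlx hw0 hR)
      omega
    have hj : j = 1 := by
      have h1 := H.lead_mul hw ha'
      rw [← h'] at h1
      have := H.lead_unique_deg h1 (H.lead_mul hlx hw) (H.lead_mul_ne hS hw ha' hw0 ha'0)
        (H.lead_mul_ne hS hlx hw hR hw0)
      omega
    subst hi hj
    obtain ⟨b, hb, z, hz, hbz⟩ := skewLT_succ_bot ha.2
    rw [skewLT_zero_eq hz, zero_mul, add_zero, pow_one, sub_eq_iff_eq_add'] at hbz
    obtain ⟨b', hb', z', hz', hbz'⟩ := skewLT_succ_bot ha'.2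
    rw [skewLT_zero_eq hz', zero_mul, add_zero, pow_one, sub_eq_iff_eq_add'] at hbz'
    subst hbz hbz'
    obtain ⟨e, he, hae⟩ := hr a (H.le ha.1)
    obtain ⟨f, hf, hbf⟩ := hr b (H.le hb)
    have he := (H.mem_of_mul_eq_right hS hw hw0 ha.1 he hae).1
    have hf := (H.mem_of_mul_eq_right hS hw hw0 hb hf hbf).1
    have h1 : x = e * (a' * x + b') + f := by
      refine mul_left_cancel_in hT H.x_mem (T.add_mem (T.mul_mem (H.le he) hc') (H.le hf)) hu hu0 ?_
      rw [h, add_mul, mul_assoc, h', ← mul_assoc, hae, hbf]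
      noncomm_ring
    have h2 : e * a' = 1 := by
      refine H.lead_unique_coeff (n := 1) (u := x) ⟨S.mul_mem he ha'.1, ?_⟩ hlx
      have h3 : x - e * a' * x ^ 1 = e * b' + f := by
        nth_rw 1 [h1]
        rw [pow_one]; noncomm_ring
      rw [h3]
      exact mem_skewLT_one (S.add_mem (S.mul_mem he hb') hf)
    obtain ⟨t, rfl⟩ := hU e he a' ha'.1 h2
    have hat : a = algebraMap K R t := by
      refine mul_right_cancel_in hT (H.le ha.1) (T.algebraMap_mem t) hu hu0 ?_
      rw [hae, Algebra.commutes]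
    have ht0 : t ≠ 0 := by
      rintro rfl
      exact ha0 (by rw [hat, map_zero])
    rw [hat, ← Algebra.smul_def] at h
    have hb0 := H.const_eq_zero hS ht0 hb _ (mem_of_lead hw) hu0 h
    refine ⟨Units.mk0 t ht0, ?_⟩
    rw [h, hb0, add_zero, smul_mul_assoc, Units.val_mk0]

end IsOreExt
end OreExtension

section CGLProof

variable {K : Type*} [Field K] {R : Type*} [Ring R] [Algebra K R] {N r : ℕ}

theorem tpow_add (t : Fin r → Kˣ) (m m' : Fin r → ℤ) : tpow t (m + m') = tpow t m * tpow t m' := by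
  simp [tpow, zpow_add, Finset.prod_mul_distrib]

theorem tpow_zero (t : Fin r → Kˣ) : tpow t 0 = 1 := by simp [tpow]

theorem tpow_inv (t : Fin r → Kˣ) (m : Fin r → ℤ) : tpow t⁻¹ m = (tpow t m)⁻¹ := by
  simp [tpow]

theorem xmon_update (x : Fin N → R) (k : Fin N) (f : Fin N → ℕ) (n : ℕ)
    (hf : ∀ i, k ≤ i → f i = 0) : xmon x (Function.update f k n) = xmon x f * x k ^ n := by
  have one : ∀ l : List (Fin N), (∀ i ∈ l, k < i) →
      (l.map fun i => x i ^ Function.update f k n i).prod = 1 ∧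
      (l.map fun i => x i ^ f i).prod = 1 := fun l hl => by
    refine ⟨List.prod_eq_one ?_, List.prod_eq_one ?_⟩ <;>
    · intro a ha
      obtain ⟨i, hi, rfl⟩ := List.mem_map.1 ha
      simp [hf i (hl i hi).le, (hl i hi).ne']
  have key : ∀ l : List (Fin N), l.Pairwise (· < ·) → k ∈ l →
      (l.map fun i => x i ^ Function.update f k n i).prod =
        (l.map fun i => x i ^ f i).prod * x k ^ n := by
    intro l
    induction l with
    | nil => simp
    | cons a l ih =>
      intro hl hk
      rw [List.pairwise_cons] at hl
      by_cases hak : a = k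
      · subst hak
        have := one l hl.1
        simp [this.1, this.2, hf a le_rfl]
      · have := ih hl.2 ((List.mem_cons.1 hk).resolve_left (Ne.symm hak))
        simp only [List.map_cons, List.prod_cons, this, Function.update_of_ne hak, mul_assoc]
  exact key _ (List.pairwise_lt_finRange N) (List.mem_finRange k)

namespace CGLData

variable (E : CGLData K R N r)

theorem act_of_mem (t : Fin r → Kˣ) {m : Fin r → ℤ} {a : R} (ha : a ∈ E.A m) :
    E.act t a = ((tpow t m : Kˣ) : K) • a := by
  let _ := E.graded
  let _ : ∀ (m : Fin r → ℤ) (z : ↥(E.A m)), Decidable (z ≠ 0) := fun _ _ => Classical.dec _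
  lift a to E.A m using ha
  simp only [act, DirectSum.decompose_coe]
  exact DFinsupp.sum_single_index (by simp)

theorem act_add (t : Fin r → Kˣ) (a b : R) : E.act t (a + b) = E.act t a + E.act t b := by
  let _ := E.graded
  let _ : ∀ (m : Fin r → ℤ) (z : ↥(E.A m)), Decidable (z ≠ 0) := fun _ _ => Classical.dec _
  simp only [act, DirectSum.decompose_add]
  exact DFinsupp.sum_add_index (by simp) (by simp)

/-- Induction over homogeneous elements. -/
theorem homogeneous_induction {p : R → Prop} (h0 : p 0) (hm : ∀ m, ∀ a ∈ E.A m, p a)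
    (hadd : ∀ a b, p a → p b → p (a + b)) (a : R) : p a := by
  let _ := E.graded
  exact DirectSum.Decomposition.inductionOn E.A h0 (fun m => hm _ _ m.2) hadd a

theorem act_zero (t : Fin r → Kˣ) : E.act t 0 = 0 := by
  have := E.act_add t 0 0
  simpa using this

theorem act_mul (t : Fin r → Kˣ) (a b : R) : E.act t (a * b) = E.act t a * E.act t b := by
  let _ := E.graded
  induction a using E.homogeneous_induction with
  | h0 => simp [act_zero]
  | hadd a a' h h' => rw [add_mul, act_add, act_add, h, h', add_mul]
  | hm m a ha =>
    induction b using E.homogeneous_induction with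
    | h0 => simp [act_zero]
    | hadd b b' h h' => rw [mul_add, act_add, act_add, h, h', mul_add]
    | hm m' b hb =>
      rw [E.act_of_mem t ha, E.act_of_mem t hb, E.act_of_mem t (SetLike.GradedMul.mul_mem ha hb),
        tpow_add, smul_mul_smul_comm, Units.val_mul]

theorem act_algebraMap (t : Fin r → Kˣ) (c : K) : E.act t (algebraMap K R c) = algebraMap K R c := by
  let _ := E.graded
  rw [E.act_of_mem t (SetLike.algebraMap_mem_graded E.A c), tpow_zero, Units.val_one, one_smul]

theorem act_act_inv (t s : Fin r → Kˣ) (h : t * s = 1) (a : R) : E.act t (E.act s a) = a := by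
  induction a using E.homogeneous_induction with
  | h0 => simp [act_zero]
  | hadd b b' h h' => rw [act_add, act_add, h, h']
  | hm m a ha =>
    obtain rfl := eq_inv_of_mul_eq_one_right h
    rw [E.act_of_mem _ ha, E.act_of_mem _ (Submodule.smul_mem _ _ ha), tpow_inv, smul_smul,
      ← Units.val_mul, mul_inv_cancel, Units.val_one, one_smul]

/-- The action of a torus element as an algebra automorphism. -/
noncomputable def actEquiv (t : Fin r → Kˣ) : R ≃ₐ[K] R where
  toFun := E.act t
  invFun := E.act t⁻¹
  left_inv := E.act_act_inv _ _ (inv_mul_cancel t)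
  right_inv := E.act_act_inv _ _ (mul_inv_cancel t)
  map_mul' := E.act_mul t
  map_add' := E.act_add t
  commutes' := E.act_algebraMap t

theorem actEquiv_apply (t : Fin r → Kˣ) (a : R) : E.actEquiv t a = E.act t a := rfl

theorem x_mem_sub {j : Fin N} {k : ℕ} (h : (j : ℕ) < k) : E.x j ∈ E.sub k :=
  Algebra.subset_adjoin ⟨j, h, rfl⟩

theorem sub_mono {k l : ℕ} (h : k ≤ l) : E.sub k ≤ E.sub l :=
  Algebra.adjoin_mono fun _ ⟨j, hj, e⟩ => ⟨j, hj.trans_le h, e⟩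

theorem sub_zero : E.sub 0 = ⊥ := by
  have : {y : R | ∃ j : Fin N, (j : ℕ) < 0 ∧ y = E.x j} = ∅ := by ext; simp
  rw [sub, this, Algebra.adjoin_empty]

theorem x_mul_eq (k : Fin N) (a : R) : E.x k * a = E.act (E.h k) a * E.x k + E.D k a := by
  simp [D]

variable {E} (hE : E.IsCGL)
include hE

namespace IsCGL

theorem act_x (t : Fin r → Kˣ) (j : Fin N) :
    E.act t (E.x j) = ((tpow t (E.ρ j) : Kˣ) : K) • E.x j := E.act_of_mem t (hE.xhom j)

theorem act_mem (t : Fin r → Kˣ) (k : ℕ) {a : R} (ha : a ∈ E.sub k) : E.act t a ∈ E.sub k := by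
  have : E.sub k ≤ (E.sub k).comap (E.actEquiv t : R →ₐ[K] R) := by
    refine Algebra.adjoin_le ?_
    rintro _ ⟨j, hj, rfl⟩
    change E.act t (E.x j) ∈ E.sub k
    rw [hE.act_x]
    exact (E.sub k).smul_mem (E.x_mem_sub hj) _
  exact this ha

theorem act_mem_iff (t : Fin r → Kˣ) (k : ℕ) (a : R) : E.act t a ∈ E.sub k ↔ a ∈ E.sub k :=
  ⟨fun h => by simpa [E.act_act_inv t⁻¹ t (inv_mul_cancel t)] using hE.act_mem t⁻¹ k h,
    hE.act_mem t k⟩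

theorem linearIndependent : LinearIndependent K (xmon E.x) := by
  rw [linearIndependent_iff]
  intro c hc
  obtain ⟨c', -, hu⟩ := hE.pbw 0
  rw [hu c hc.symm, hu 0 (by simp)]

theorem span_eq_top : ⊤ ≤ Submodule.span K (Set.range (xmon E.x)) := by
  intro a _
  obtain ⟨c, rfl, -⟩ := hE.pbw a
  exact Submodule.sum_mem _ fun f _ => Submodule.smul_mem _ _ (Submodule.subset_span ⟨f, rfl⟩)

theorem sub_eq_top : E.sub N = ⊤ := by
  rw [eq_top_iff]
  rintro a -
  obtain ⟨c, rfl, -⟩ := hE.pbw a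
  refine Subalgebra.sum_mem _ fun f _ => Subalgebra.smul_mem _ (Subalgebra.list_prod_mem _ ?_) _
  intro b hb
  obtain ⟨i, -, rfl⟩ := List.mem_map.1 hb
  exact Subalgebra.pow_mem _ (E.x_mem_sub i.2) _

theorem der_mem (k : Fin N) {a : R} (ha : a ∈ E.sub (k : ℕ)) :
    skewDer (E.x k) (E.actEquiv (E.h k)) a ∈ E.sub (k : ℕ) := hE.delta_stab k a ha

theorem mem_sub_succ (k : Fin N) (u : R) :
    u ∈ E.sub ((k : ℕ) + 1) ↔ ∃ n, u ∈ skewLT (E.sub (k : ℕ)) (E.x k) n := by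
  have hσ : ∀ a ∈ E.sub (k : ℕ), E.actEquiv (E.h k) a ∈ E.sub (k : ℕ) := hE.sigma_stab k
  constructor
  · intro hu
    induction hu using Algebra.adjoin_induction with
    | mem u h =>
      obtain ⟨j, hj, rfl⟩ := h
      rcases Nat.lt_succ_iff_lt_or_eq.1 hj with hj | hj
      · exact ⟨1, mem_skewLT_one (E.x_mem_sub hj)⟩
      · obtain rfl := Fin.ext hj
        refine ⟨2, ?_⟩
        simpa using mul_pow_mem_skewLT (x := E.x j) (E.sub (j : ℕ)).one_mem Nat.one_lt_two
    | algebraMap c => exact ⟨1, mem_skewLT_one ((E.sub (k : ℕ)).algebraMap_mem c)⟩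
    | add u v _ _ hu hv =>
      obtain ⟨n, hn⟩ := hu
      obtain ⟨m, hm⟩ := hv
      exact ⟨n + m, Submodule.add_mem _ (skewLT_mono (by omega) hn) (skewLT_mono (by omega) hm)⟩
    | mul u v _ _ hu hv =>
      obtain ⟨n, hn⟩ := hu
      obtain ⟨m, hm⟩ := hv
      exact ⟨n + m, mul_mem_skewLT hσ (fun _ => hE.der_mem k) hn (skewLT_mono (by omega) hm)⟩
  · rintro ⟨n, hn⟩
    refine skewLT_map_mem LinearMap.id (Subalgebra.toSubmodule (E.sub ((k : ℕ) + 1)))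
      (fun a ha i _ => ?_) hn
    exact Subalgebra.mul_mem _ (E.sub_mono (Nat.le_succ _) ha)
      (Subalgebra.pow_mem _ (E.x_mem_sub (Nat.lt_succ_self _)) _)

theorem sub_le_span (k : ℕ) (hk : k ≤ N) {a : R} (ha : a ∈ E.sub k) :
    a ∈ Submodule.span K {u | ∃ f : Fin N → ℕ, (∀ i : Fin N, k ≤ i → f i = 0) ∧ u = xmon E.x f} := by
  induction k generalizing a with
  | zero =>
    rw [E.sub_zero, Algebra.mem_bot] at ha
    obtain ⟨c, rfl⟩ := ha
    rw [Algebra.algebraMap_eq_smul_one]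
    refine Submodule.smul_mem _ _ (Submodule.subset_span ⟨0, by simp, ?_⟩)
    exact (List.prod_eq_one (by simp)).symm
  | succ k ih =>
    obtain ⟨n, hn⟩ := (hE.mem_sub_succ ⟨k, hk⟩ a).1 ha
    refine skewLT_map_mem LinearMap.id _ (fun b hb j _ => ?_) hn
    replace hb := ih (by omega) hb
    rw [LinearMap.id_apply]
    induction hb using Submodule.span_induction with
    | mem u h =>
      obtain ⟨f, hf, rfl⟩ := h
      refine Submodule.subset_span ⟨Function.update f ⟨k, hk⟩ j, fun i hi => ?_,
        (xmon_update _ _ _ _ fun i hi => hf i hi).symm⟩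
      rw [Function.update_of_ne (by rintro rfl; simp at hi), hf i (by omega)]
    | zero => rw [zero_mul]; exact Submodule.zero_mem _
    | add u v _ _ hu hv => rw [add_mul]; exact Submodule.add_mem _ hu hv
    | smul t u _ hu => rw [smul_mul_assoc]; exact Submodule.smul_mem _ _ hu

theorem exists_coeff (k : Fin N) : ∃ P : ℕ → R →ₗ[K] R, ∀ a ∈ E.sub (k : ℕ), ∀ i j,
    P i (a * E.x k ^ j) = if i = j then a else 0 := by
  let B := Module.Basis.mk hE.linearIndependent hE.span_eq_top
  refine ⟨fun i => B.constr K fun f => if f k = i then xmon E.x (Function.update f k 0) else 0,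
    fun a ha i j => ?_⟩
  replace ha := hE.sub_le_span k k.2.le ha
  induction ha using Submodule.span_induction with
  | mem u h =>
    obtain ⟨f, hf, rfl⟩ := h
    have hB := B.constr_basis K
      (fun f => if f k = i then xmon E.x (Function.update f k 0) else 0) (Function.update f k j)
    rw [Module.Basis.mk_apply] at hB
    rw [← xmon_update _ _ _ _ fun i hi => hf i hi, hB, Function.update_self, Function.update_idem]
    have : Function.update f k 0 = f := by rw [← hf k le_rfl, Function.update_eq_self]
    simp only [this, eq_comm]
  | zero => simp
  | add u v _ _ hu hv => rw [add_mul, map_add, hu, hv]; split_ifs <;> simp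
  | smul t u _ hu => rw [smul_mul_assoc, map_smul, hu, smul_ite, smul_zero]

theorem isOreExt (k : Fin N) : IsOreExt (E.sub (k : ℕ)) (E.sub ((k : ℕ) + 1)) (E.x k)
    (E.actEquiv (E.h k)) ((tpow (E.h k) (E.ρ k) : Kˣ) : K) where
  mem_iff := hE.mem_sub_succ k
  stab := hE.act_mem_iff _ _
  der _ := hE.der_mem k
  coeff := hE.exists_coeff k
  nil := hE.delta_nil k
  map_x := hE.act_x _ _
  q_ne := Units.ne_zero _
  notroot n hn h := hE.notroot k n hn (Units.ext (by
    rw [Units.val_pow_eq_pow_val, h, Units.val_one]))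

theorem noZeroDiv_unitsScalar (k : ℕ) (hk : k ≤ N) :
    NoZeroDivIn (E.sub k) ∧ UnitsScalar (E.sub k) := by
  induction k with
  | zero =>
    simp only [NoZeroDivIn, UnitsScalar, E.sub_zero, Algebra.mem_bot]
    refine ⟨?_, ?_⟩
    · rintro _ ⟨s, rfl⟩ _ ⟨t, rfl⟩ h
      rcases eq_or_ne s 0 with rfl | hs
      · simp
      · right
        rw [← map_mul] at h
        have := congrArg (algebraMap K R s⁻¹ * ·) h
        simpa [← map_mul, hs] using this
    · rintro _ ⟨s, rfl⟩ _ _ _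
      exact ⟨s, rfl⟩
  | succ k ih =>
    obtain ⟨h1, h2⟩ := ih (by omega)
    have H := hE.isOreExt ⟨k, hk⟩
    exact ⟨H.noZeroDiv h1, H.unitsScalar h1 h2⟩

theorem noZeroDiv (k : ℕ) (hk : k ≤ N) : NoZeroDivIn (E.sub k) := (hE.noZeroDiv_unitsScalar k hk).1

/-- Normal elements of `R_k` commute with the generators of `R_k` up to scalars. -/
theorem quasiCommute (k : ℕ) (hk : k ≤ N) {u : R} (hu : u ∈ E.sub k) (hu0 : u ≠ 0)
    (hl : ∀ a ∈ E.sub k, ∃ b ∈ E.sub k, u * a = b * u)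
    (hr : ∀ a ∈ E.sub k, ∃ b ∈ E.sub k, a * u = u * b) (j : Fin N) (hj : (j : ℕ) < k) :
    ∃ t : Kˣ, u * E.x j = (t : K) • (E.x j * u) := by
  induction k generalizing u with
  | zero => omega
  | succ k ih =>
    obtain ⟨h1, h2⟩ := hE.noZeroDiv_unitsScalar k (by omega)
    have H := hE.isOreExt ⟨k, hk⟩
    obtain ⟨w, hw, hw0, hwl, hwr, hS, hx⟩ := H.normal_lead h1 h2 hu hu0 hl hr
    rcases Nat.lt_succ_iff_lt_or_eq.1 hj with hj | rfl
    · obtain ⟨t, ht⟩ := ih (by omega) hw hw0 hwl hwr hj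
      exact hS _ (E.x_mem_sub hj) _ t (hE.act_x _ j) ht
    · exact hx

theorem quasiCommute_of_normalIn (k : ℕ) (hk : k ≤ N) {u : R} (hu : u ∈ E.sub k) (hu0 : u ≠ 0)
    (hn : NormalIn (E.sub k : Set R) u) (j : Fin N) (hj : (j : ℕ) < k) :
    ∃ t : Kˣ, u * E.x j = (t : K) • (E.x j * u) :=
  hE.quasiCommute k hk hu hu0 (fun a ha => (Set.ext_iff.1 hn (u * a)).1 ⟨a, ha, rfl⟩)
    (fun a ha => (Set.ext_iff.1 hn (a * u)).2 ⟨a, ha, rfl⟩) j hj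

theorem quasiCommute_of_isNormalElem {u : R} (hu0 : u ≠ 0) (hn : IsNormalElem u) (j : Fin N) :
    ∃ t : Kˣ, u * E.x j = (t : K) • (E.x j * u) := by
  refine hE.quasiCommute_of_normalIn N le_rfl (by rw [hE.sub_eq_top]; trivial) hu0 ?_ j j.2
  rw [hE.sub_eq_top]
  simpa [NormalIn, IsNormalElem] using hn

/-- Elements `a x_k + b` and `a' x_k + b'` with coefficients in `R_{k-1}` agree only if their
leading coefficients do. -/
theorem coeff_unique (k : Fin N) {a b a' b' : R} (ha : a ∈ E.sub (k : ℕ)) (hb : b ∈ E.sub (k : ℕ))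
    (ha' : a' ∈ E.sub (k : ℕ)) (hb' : b' ∈ E.sub (k : ℕ))
    (h : a * E.x k + b = a' * E.x k + b') : a = a' := by
  have key : ∀ {a b : R}, a ∈ E.sub (k : ℕ) → b ∈ E.sub (k : ℕ) →
      HasLead (E.sub (k : ℕ)) (E.x k) 1 a (a * E.x k + b) := fun ha hb =>
    ⟨ha, by simpa using mem_skewLT_one hb⟩
  refine (hE.isOreExt k).lead_unique_coeff (key ha hb) ?_
  rw [h]
  exact key ha' hb'

theorem coeff_unique_sq (k : Fin N) {a b c a' b' c' : R} (ha : a ∈ E.sub (k : ℕ))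
    (hb : b ∈ E.sub (k : ℕ)) (hc : c ∈ E.sub (k : ℕ)) (ha' : a' ∈ E.sub (k : ℕ))
    (hb' : b' ∈ E.sub (k : ℕ)) (hc' : c' ∈ E.sub (k : ℕ))
    (h : a * E.x k ^ 2 + b * E.x k + c = a' * E.x k ^ 2 + b' * E.x k + c') : a = a' := by
  have key : ∀ {a b c : R}, a ∈ E.sub (k : ℕ) → b ∈ E.sub (k : ℕ) → c ∈ E.sub (k : ℕ) →
      HasLead (E.sub (k : ℕ)) (E.x k) 2 a (a * E.x k ^ 2 + b * E.x k + c) := fun {a b c} ha hb hc => by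
    refine ⟨ha, ?_⟩
    rw [add_assoc, add_sub_cancel_left]
    refine Submodule.add_mem _ ?_ (skewLT_mono one_le_two (mem_skewLT_one hc))
    simpa using mul_pow_mem_skewLT (x := E.x k) hb one_lt_two
  refine (hE.isOreExt k).lead_unique_coeff (key ha hb hc) ?_
  rw [h]
  exact key ha' hb' hc'

end IsCGL

section Struct

variable {n : ℕ} {μ : Fin N → Fin n} {d y : Fin N → R} (hs : E.StructData μ d y)

omit hE in
theorem exists_isPred {k : Fin N} (h : ¬ PInf μ k) : ∃ j, IsPred μ j k := by
  classical
  simp only [PInf, not_forall, not_not] at h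
  obtain ⟨j, hj, hμ⟩ := h
  let s := Finset.univ.filter fun i : Fin N => i < k ∧ μ i = μ k
  have hne : s.Nonempty := ⟨j, by simp [s, hj, hμ]⟩
  have hm := s.max'_mem hne
  simp only [s, Finset.mem_filter, Finset.mem_univ, true_and] at hm
  refine ⟨s.max' hne, hm.1, hm.2, fun j' h1 h2 h3 => ?_⟩
  exact h1.not_ge (s.le_max' j' (by simp [s, h2, h3]))

/-- `∏_{m=0}^{O₋(j)} f(p^m(j))`. -/
def chainProd (μ : Fin N → Fin n) (f : Fin N → Kˣ) (j : Fin N) : Kˣ :=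
  ∏ m ∈ Finset.univ.filter fun m : Fin N => m ≤ j ∧ μ m = μ j, f m

omit hE in
theorem chainProd_of_pInf (f : Fin N → Kˣ) {j : Fin N} (h : PInf μ j) : chainProd μ f j = f j := by
  have : (Finset.univ.filter fun m : Fin N => m ≤ j ∧ μ m = μ j) = {j} := by
    ext m
    simp only [Finset.mem_filter, Finset.mem_univ, true_and, Finset.mem_singleton]
    refine ⟨fun hm => hm.1.eq_of_not_lt fun hlt => h m hlt hm.2, by rintro rfl; simp⟩
  rw [chainProd, this, Finset.prod_singleton]

omit hE in
theorem chainProd_of_isPred (f : Fin N → Kˣ) {l j : Fin N} (h : IsPred μ l j) :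
    chainProd μ f j = f j * chainProd μ f l := by
  have : (Finset.univ.filter fun m : Fin N => m ≤ j ∧ μ m = μ j) =
      insert j (Finset.univ.filter fun m : Fin N => m ≤ l ∧ μ m = μ l) := by
    ext m
    simp only [Finset.mem_filter, Finset.mem_univ, true_and, Finset.mem_insert, h.2.1]
    constructor
    · rintro ⟨h1, h2⟩
      refine h1.eq_or_lt.imp id fun h1 => ⟨not_lt.1 fun h3 => h.2.2 m h3 h1 h2, h2⟩
    · rintro (rfl | ⟨h1, h2⟩)
      · simp
      · exact ⟨h1.trans h.1.le, h2⟩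
  rw [chainProd, this, Finset.prod_insert, chainProd]
  simp [h.1]

omit hE in
theorem alpha_eq (k j : Fin N) : E.alpha μ k j = chainProd μ (E.lam k) j := rfl

include hs

omit hE in
theorem StructData.y_prime (j k : Fin N) (hjk : j ≤ k) (h : SGt μ j k) :
    IsPrimeElemIn (E.sub ((k : ℕ) + 1) : Set R) (y j) :=
  ((hs.2.2.2.2.1 k).1 j hjk h).1

omit hE in
theorem StructData.y_mem (j : Fin N) : y j ∈ E.sub ((j : ℕ) + 1) :=
  (hs.y_prime j j le_rfl fun _ h h' => absurd h h'.not_gt).1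

omit hE in
theorem StructData.y_ne (j : Fin N) : y j ≠ 0 :=
  (hs.y_prime j j le_rfl fun _ h h' => absurd h h'.not_gt).2.1

omit hE in
theorem StructData.y_mem_of_lt {j k : Fin N} (h : j < k) : y j ∈ E.sub (k : ℕ) :=
  E.sub_mono h (hs.y_mem j)

theorem StructData.act_y (t : Fin r → Kˣ) (j : Fin N) :
    E.act t (y j) = ((chainProd μ (fun m => tpow t (E.ρ m)) j : Kˣ) : K) • y j := by
  induction j using WellFoundedLT.induction with
  | ind j ih =>
    by_cases hp : PInf μ j
    · rw [chainProd_of_pInf _ hp, hs.2.1 j hp, hE.act_x]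
    obtain ⟨l, hl⟩ := exists_isPred hp
    obtain ⟨hd, hy⟩ := hs.2.2.1 j l hl
    obtain ⟨m, hm⟩ := hs.2.2.2.1 j
    have hyl := hs.y_mem_of_lt hl.1
    have h1 := E.act_of_mem t hm
    rw [h1]
    have h2 : E.act t (y j) = E.act t (y l) * E.act t (E.x j) - E.act t (d j) := by
      rw [hy]
      simp only [← actEquiv_apply, map_sub, map_mul]
    rw [h1, ih l hl.1, hE.act_x, hy] at h2
    have h3 := hE.coeff_unique j
      (a := ((tpow t m : Kˣ) : K) • y l) (b := -(((tpow t m : Kˣ) : K) • d j))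
      (a' := ((tpow t (E.ρ j) * chainProd μ (fun m => tpow t (E.ρ m)) l : Kˣ) : K) • y l)
      (b' := - E.act t (d j)) (Subalgebra.smul_mem _ hyl _)
      (Subalgebra.neg_mem _ (Subalgebra.smul_mem _ hd _)) (Subalgebra.smul_mem _ hyl _)
      (Subalgebra.neg_mem _ (hE.act_mem t _ hd)) (by
        rw [smul_mul_assoc, smul_mul_assoc, ← sub_eq_add_neg, ← sub_eq_add_neg, ← smul_sub, h2,
          smul_mul_smul_comm, mul_comm (tpow t (E.ρ j)), Units.val_mul])
    rw [chainProd_of_isPred _ hl]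
    rw [smul_left_injective K (hs.y_ne l) h3]

theorem StructData.quasiCommute {j k : Fin N} (h : SGt μ j k) :
    ∃ t : Kˣ, y j * E.x k = (t : K) • (E.x k * y j) := by
  rcases le_or_gt j k with hjk | hjk
  · obtain ⟨h1, h2, h3, -⟩ := hs.y_prime j k hjk h
    exact hE.quasiCommute_of_normalIn _ k.2 h1 h2 h3 k (Nat.lt_succ_self _)
  · obtain ⟨h1, h2, h3, -⟩ := hs.y_prime j j le_rfl fun _ h h' => absurd h h'.not_gt
    exact hE.quasiCommute_of_normalIn _ j.2 h1 h2 h3 k (Nat.lt_succ_of_lt hjk)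

omit hE hs in
theorem smul_injective_of_ne {a : R} (ha : a ≠ 0) {s t : Kˣ} (h : (s : K) • a = (t : K) • a) :
    s = t := Units.ext (smul_left_injective K ha h)

theorem StructData.commute_scalar {j k : Fin N} (h : SGt μ j k) {t : Kˣ}
    (ht : y j * E.x k = (t : K) • (E.x k * y j)) : t = (E.alpha μ k j)⁻¹ := by
  have hx0 : ∀ k, E.x k ≠ 0 := hE.xne
  induction j using WellFoundedLT.induction generalizing t with
  | ind j ih =>
  rcases lt_trichotomy j k with hjk | rfl | hjk
  · have hy := hs.y_mem_of_lt hjk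
    rw [E.x_mul_eq, hs.act_y hE, smul_add, smul_mul_assoc, smul_smul, ← Units.val_mul,
      ← smul_mul_assoc] at ht
    have h1 := hE.coeff_unique k (b := 0) hy (Subalgebra.zero_mem _) (Subalgebra.smul_mem _ hy _)
      (Subalgebra.smul_mem _ (hE.delta_stab k _ hy) _) (by rw [add_zero]; exact ht)
    have h2 : (1 : Kˣ) = t * chainProd μ (fun m => tpow (E.h k) (E.ρ m)) j :=
      smul_injective_of_ne (hs.y_ne j) (by rw [Units.val_one, one_smul]; exact h1)
    have h3 : E.alpha μ k j = chainProd μ (fun m => tpow (E.h k) (E.ρ m)) j := by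
      refine Finset.prod_congr rfl fun m hm => ?_
      simp only [Finset.mem_filter] at hm
      rw [lam, if_pos (hm.2.1.trans_lt hjk)]
    rw [h3]
    exact eq_inv_of_mul_eq_one_left h2.symm
  · have hlam : E.lam j j = 1 := by simp [lam]
    by_cases hp : PInf μ j
    · rw [alpha_eq, chainProd_of_pInf _ hp, hlam, inv_one]
      rw [hs.2.1 j hp] at ht
      have hxx : E.x j * E.x j ≠ 0 := fun h0 => by
        have hm := E.x_mem_sub j.2
        exact (hE.noZeroDiv N le_rfl _ hm _ hm h0).elim (hx0 j) (hx0 j)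
      exact (smul_injective_of_ne hxx (by rw [Units.val_one, one_smul]; exact ht)).symm
    · obtain ⟨l, hl⟩ := exists_isPred hp
      obtain ⟨hd, hy⟩ := hs.2.2.1 j l hl
      have hyl := hs.y_mem_of_lt hl.1
      have h3 : E.alpha μ j j = chainProd μ (fun m => tpow (E.h j) (E.ρ m)) l := by
        rw [alpha_eq, chainProd_of_isPred _ hl, hlam, one_mul]
        refine Finset.prod_congr rfl fun m hm => ?_
        simp only [Finset.mem_filter] at hm
        rw [lam, if_pos (hm.2.1.trans_lt hl.1)]
      rw [hy, sub_mul, mul_sub, ← mul_assoc, E.x_mul_eq j (y l), E.x_mul_eq j (d j),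
        hs.act_y hE] at ht
      have h1 := hE.coeff_unique_sq j (a := y l) (b := -d j) (c := 0)
        (a' := (t : K) • ((chainProd μ (fun m => tpow (E.h j) (E.ρ m)) l : Kˣ) : K) • y l)
        (b' := (t : K) • (E.D j (y l) - E.act (E.h j) (d j))) (c' := -((t : K) • E.D j (d j)))
        hyl (Subalgebra.neg_mem _ hd) (Subalgebra.zero_mem _)
        (Subalgebra.smul_mem _ (Subalgebra.smul_mem _ hyl _) _)
        (Subalgebra.smul_mem _ (Subalgebra.sub_mem _ (hE.delta_stab j _ hyl)
          (hE.sigma_stab j _ hd)) _)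
        (Subalgebra.neg_mem _ (Subalgebra.smul_mem _ (hE.delta_stab j _ hd) _)) (by
          have e1 : y l * E.x j ^ 2 + -d j * E.x j + 0 = y l * E.x j * E.x j - d j * E.x j := by
            rw [pow_two]; noncomm_ring
          rw [e1, ht]
          simp only [smul_sub, smul_add, smul_mul_assoc, sub_mul, add_mul, pow_two, mul_assoc]
          abel)
      rw [smul_smul, ← Units.val_mul] at h1
      have h2 : (1 : Kˣ) = t * chainProd μ (fun m => tpow (E.h j) (E.ρ m)) l :=
        smul_injective_of_ne (hs.y_ne l) (by rw [Units.val_one, one_smul]; exact h1)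
      rw [h3]
      exact eq_inv_of_mul_eq_one_left h2.symm
  · have hlam : E.lam k j = (tpow (E.h j) (E.ρ k))⁻¹ := by
      rw [lam, if_neg hjk.not_gt, if_pos hjk]
    have hxk : E.x k ∈ E.sub (j : ℕ) := E.x_mem_sub hjk
    have hδ := hE.delta_stab j _ hxk
    by_cases hp : PInf μ j
    · rw [alpha_eq, chainProd_of_pInf _ hp, hlam, inv_inv]
      rw [hs.2.1 j hp, E.x_mul_eq, hE.act_x, ← smul_mul_assoc] at ht
      refine (smul_injective_of_ne (hx0 k) ?_).symm
      exact hE.coeff_unique j (b' := 0) (Subalgebra.smul_mem _ hxk _) hδ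
        (Subalgebra.smul_mem _ hxk _) (Subalgebra.zero_mem _) (by rw [add_zero]; exact ht)
    · obtain ⟨l, hl⟩ := exists_isPred hp
      obtain ⟨hd, hy⟩ := hs.2.2.1 j l hl
      have hyl := hs.y_mem_of_lt hl.1
      have hlk : SGt μ l k := fun j' h1 h2 h3 => hl.2.2 j' h1 (h2.trans_lt hjk) (h3.trans hl.2.1)
      obtain ⟨s, hs'⟩ := hs.quasiCommute hE hlk
      have hsα := ih l hl.1 hlk hs'
      rw [hy, sub_mul, mul_sub, mul_assoc, E.x_mul_eq j (E.x k), hE.act_x] at ht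
      have h1 := hE.coeff_unique j
        (a := ((tpow (E.h j) (E.ρ k) : Kˣ) : K) • (y l * E.x k))
        (b := y l * E.D j (E.x k) - d j * E.x k)
        (a' := (t : K) • (E.x k * y l)) (b' := -((t : K) • (E.x k * d j)))
        (Subalgebra.smul_mem _ (Subalgebra.mul_mem _ hyl hxk) _)
        (Subalgebra.sub_mem _ (Subalgebra.mul_mem _ hyl hδ) (Subalgebra.mul_mem _ hd hxk))
        (Subalgebra.smul_mem _ (Subalgebra.mul_mem _ hxk hyl) _)
        (Subalgebra.neg_mem _ (Subalgebra.smul_mem _ (Subalgebra.mul_mem _ hxk hd) _)) (by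
          have e1 : (((tpow (E.h j) (E.ρ k) : Kˣ) : K) • (y l * E.x k)) * E.x j +
              (y l * E.D j (E.x k) - d j * E.x k) =
              y l * ((((tpow (E.h j) (E.ρ k) : Kˣ) : K) • E.x k) * E.x j + E.D j (E.x k)) -
                d j * E.x k := by
            simp only [smul_mul_assoc, mul_add, mul_smul_comm, mul_assoc]
            abel
          rw [e1, ht, smul_sub, smul_mul_assoc, mul_assoc, sub_eq_add_neg])
      rw [hs', smul_smul, ← Units.val_mul] at h1
      have hxy : E.x k * y l ≠ 0 := fun h0 =>
        (hE.noZeroDiv j j.2.le _ hxk _ hyl h0).elim (hx0 k) (hs.y_ne l)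
      rw [← smul_injective_of_ne hxy h1, hsα, alpha_eq, alpha_eq, chainProd_of_isPred _ hl, hlam,
        mul_inv, inv_inv]

end Struct
end CGLData
end CGLProof

/-- An element commuting up to scalars with the generators of a subalgebra normalizes it. -/
theorem mul_adjoin_eq_adjoin_mul {K : Type*} [Field K] {R : Type*} [Ring R] [Algebra K R]
    (x : R) {s : Set R} (h : ∀ u ∈ s, ∃ t : Kˣ, u * x = (t : K) • (x * u)) :
    {z : R | ∃ a ∈ (Algebra.adjoin K s : Set R), z = x * a} =
      {z : R | ∃ a ∈ (Algebra.adjoin K s : Set R), z = a * x} := by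
  refine Set.Subset.antisymm ?_ ?_
  · rintro _ ⟨a, ha, rfl⟩
    change a ∈ Algebra.adjoin K s at ha
    induction ha using Algebra.adjoin_induction with
    | mem u hu =>
      obtain ⟨t, ht⟩ := h u hu
      refine ⟨((t⁻¹ : Kˣ) : K) • u, Subalgebra.smul_mem _ (Algebra.subset_adjoin hu) _, ?_⟩
      rw [smul_mul_assoc, ht, smul_smul, ← Units.val_mul, inv_mul_cancel, Units.val_one, one_smul]
    | algebraMap c => exact ⟨_, Subalgebra.algebraMap_mem _ c, (Algebra.commutes c x).symm⟩
    | add u v _ _ hu hv =>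
      obtain ⟨a, ha, hu⟩ := hu
      obtain ⟨b, hb, hv⟩ := hv
      exact ⟨a + b, Subalgebra.add_mem _ ha hb, by rw [mul_add, hu, hv, add_mul]⟩
    | mul u v _ _ hu hv =>
      obtain ⟨a, ha, hu⟩ := hu
      obtain ⟨b, hb, hv⟩ := hv
      exact ⟨a * b, Subalgebra.mul_mem _ ha hb, by rw [← mul_assoc, hu, mul_assoc, hv, mul_assoc]⟩
  · rintro _ ⟨a, ha, rfl⟩
    change a ∈ Algebra.adjoin K s at ha
    induction ha using Algebra.adjoin_induction with
    | mem u hu =>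
      obtain ⟨t, ht⟩ := h u hu
      exact ⟨(t : K) • u, Subalgebra.smul_mem _ (Algebra.subset_adjoin hu) _, by
        rw [ht, mul_smul_comm]⟩
    | algebraMap c => exact ⟨_, Subalgebra.algebraMap_mem _ c, Algebra.commutes c x⟩
    | add u v _ _ hu hv =>
      obtain ⟨a, ha, hu⟩ := hu
      obtain ⟨b, hb, hv⟩ := hv
      exact ⟨a + b, Subalgebra.add_mem _ ha hb, by rw [add_mul, hu, hv, mul_add]⟩
    | mul u v _ _ hu hv =>
      obtain ⟨a, ha, hu⟩ := hu
      obtain ⟨b, hb, hv⟩ := hv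
      exact ⟨a * b, Subalgebra.mul_mem _ ha hb, by rw [mul_assoc, hv, ← mul_assoc, hu, mul_assoc]⟩

/-- **Corollary 4.11** of Goodearl–Yakimov: for a CGL extension `R` with the
structure-theorem data `(μ, d, y)`, one has `y_j·x_k = α_{kj}⁻¹·x_k·y_j`
whenever `s(j) > k`; consequently every homogeneous prime element of `R`
quasi-commutes with `x₁,…,x_N`, and `x_k·N(R) = N(R)·x_k`. -/
theorem stmt16 {K : Type*} [Field K] {R : Type*} [Ring R] [Algebra K R]
    {N r : ℕ} (E : CGLData K R N r) (hE : E.IsCGL)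
    (n : ℕ) (μ : Fin N → Fin n) (d y : Fin N → R)
    (hstruct : E.StructData μ d y) :
    (∀ j k : Fin N, SGt μ j k →
      y j * E.x k = ((((E.alpha μ k j)⁻¹ : Kˣ)) : K) • (E.x k * y j)) ∧
    (∀ p : R, E.IsHomogPrimeIn Set.univ p →
      ∀ k : Fin N, ∃ t : Kˣ, p * E.x k = (t : K) • (E.x k * p)) ∧
    (∀ k : Fin N,
      {z : R | ∃ a ∈ (Algebra.adjoin K {u : R | IsNormalElem u} : Set R),
        z = E.x k * a} =
      {z : R | ∃ a ∈ (Algebra.adjoin K {u : R | IsNormalElem u} : Set R),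
        z = a * E.x k}) := by
  refine ⟨fun j k hjk => ?_, fun p hp k => ?_, fun k => ?_⟩
  · obtain ⟨t, ht⟩ := hstruct.quasiCommute hE hjk
    rw [ht, hstruct.commute_scalar hE hjk ht]
  · obtain ⟨-, h0, h, -⟩ := hp.1
    exact hE.quasiCommute_of_isNormalElem h0 (by simpa [NormalIn, IsNormalElem] using h) k
  · have hgen : ∀ u : R, IsNormalElem u →
        ∃ t : Kˣ, u * E.x k = (t : K) • (E.x k * u) := fun u hu => by
      rcases eq_or_ne u 0 with rfl | hu0
      · exact ⟨1, by simp⟩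
      · exact hE.quasiCommute_of_isNormalElem hu0 hu k
    exact mul_adjoin_eq_adjoin_mul (E.x k) hgen
end
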